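/- Let X be a Banach space with cotype q ∈ [2,∞). Then there exists a constant C (depending only on q and X) such that for every N ≥ 1 and every x_1,…,x_N ∈ X there exists a probability measure ν on {1,…,N} with the property that for all scalars a_1,…,a_N, ( E‖Σ_{n=1}^N r_n a_n x_n‖² )^{1/2} ≤ C · ‖(a_n)_{n=1}^N‖_{ℓ^{q,1}(ν)} · ( E‖Σ_{n=1}^N r_n x_n‖² )^{1/2}, where ‖·‖_{ℓ^{q,1}(ν)} denotes the Lorentz L^{q,1} norm on the measure space ({1,…,N}, ν). -/

import Mathlib

open MeasureTheory ENNReal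

noncomputable section

/-- The Rademacher average `𝔼 ‖∑ₙ rₙ xₙ‖²`, realized concretely as the average over all
sign choices `ε : Fin N → Bool`.  For a Rademacher sequence `(rₙ)` on any probability space
this equals `𝔼 ‖∑ₙ rₙ xₙ‖²`. -/
def radAvg {E : Type*} [NormedAddCommGroup E] [NormedSpace ℝ E] {N : ℕ} (x : Fin N → E) : ℝ :=
  (∑ ε : Fin N → Bool, ‖∑ n, (if ε n then (1 : ℝ) else -1) • x n‖ ^ 2) / 2 ^ N

/-- `X` has (Rademacher) type `p`:
`(𝔼 ‖∑ rₙ xₙ‖²)^(1/2) ≤ C (∑ ‖xₙ‖^p)^(1/p)`. -/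
def HasRademacherType (X : Type*) [NormedAddCommGroup X] [NormedSpace ℝ X] (p : ℝ) : Prop :=
  ∃ C : ℝ, 0 ≤ C ∧ ∀ (N : ℕ) (x : Fin N → X),
    Real.sqrt (radAvg x) ≤ C * (∑ n, ‖x n‖ ^ p) ^ (1 / p)

/-- `X` has (Rademacher) cotype `q ∈ [2,∞]`:
`(∑ ‖xₙ‖^q)^(1/q) ≤ C (𝔼 ‖∑ rₙ xₙ‖²)^(1/2)` (with `max ‖xₙ‖` on the left if `q = ∞`). -/
def HasRademacherCotype (X : Type*) [NormedAddCommGroup X] [NormedSpace ℝ X] (q : ℝ≥0∞) : Prop :=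
  ∃ C : ℝ, 0 ≤ C ∧ ∀ (N : ℕ) (x : Fin N → X),
    (if q = ∞ then ⨆ n, ‖x n‖ else (∑ n, ‖x n‖ ^ q.toReal) ^ (1 / q.toReal))
      ≤ C * Real.sqrt (radAvg x)

theorem rpow_add_mul_sub_le_rpow {p u r : ℝ} (hp : 1 < p) (hu : 0 ≤ u) (hr : 0 ≤ r) :
    u ^ p + p * u ^ (p - 1) * (r - u) ≤ r ^ p := by
  rcases hu.eq_or_lt with rfl | hu
  · rw [Real.zero_rpow (by linarith), Real.zero_rpow (by linarith)]
    simpa using Real.rpow_nonneg hr p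
  · have h := one_add_mul_self_le_rpow_one_add (s := r / u - 1)
      (by linarith [div_nonneg hr hu.le]) hp.le
    rw [add_sub_cancel, Real.div_rpow hr hu.le, le_div_iff₀ (Real.rpow_pos_of_pos hu p)] at h
    have e : u ^ p = u ^ (p - 1) * u := by
      rw [← Real.rpow_add_one hu.ne', sub_add_cancel]
    calc u ^ p + p * u ^ (p - 1) * (r - u)
        = (1 + p * (r / u - 1)) * u ^ p := by rw [e]; field_simp
      _ ≤ r ^ p := h

/-- Minkowski's inequality for a finite sum of nonnegative functions on a finite type. -/
theorem Lp_sum_le_of_nonneg {ι κ : Type*} [Fintype κ] {p : ℝ} (hp : 1 ≤ p) (s : Finset ι)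
    (g : ι → κ → ℝ) (hg : ∀ i j, 0 ≤ g i j) :
    (∑ j, (∑ i ∈ s, g i j) ^ p) ^ (1 / p) ≤ ∑ i ∈ s, (∑ j, g i j ^ p) ^ (1 / p) := by
  classical
  induction s using Finset.induction_on with
  | empty =>
    have hp0 : p ≠ 0 := by linarith
    simp [Real.zero_rpow hp0, Real.zero_rpow (inv_ne_zero hp0)]
  | insert i s hi ih =>
    simp only [Finset.sum_insert hi]
    refine (Real.Lp_add_le_of_nonneg Finset.univ hp (fun j _ => hg i j)
      (fun j _ => Finset.sum_nonneg fun k _ => hg k j)).trans ?_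
    gcongr

/-- A finite form of Pisier's factorization theorem: if `∑ⱼ ‖∑_{n ∈ Aⱼ} yₙ‖^q ≤ K` for all
partitions `(Aⱼ)`, then `‖∑_{n ∈ B} yₙ‖^q` is dominated by a measure of total mass `q K`. -/
theorem exists_measure_dominating_norm_sum_rpow {Y : Type*} [NormedAddCommGroup Y]
    [NormedSpace ℝ Y] {N : ℕ} (y : Fin N → Y) {q K : ℝ} (hq : 1 < q)
    (hK : ∀ c : Fin N → Fin (N + 1), ∑ j, ‖∑ n with c n = j, y n‖ ^ q ≤ K) :
    ∃ μ : Fin N → ℝ, (∀ n, 0 ≤ μ n) ∧ ∑ n, μ n ≤ q * K ∧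
      ∀ B : Finset (Fin N), ‖∑ n ∈ B, y n‖ ^ q ≤ ∑ n ∈ B, μ n := by
  have hq0 : q ≠ 0 := by linarith
  obtain ⟨c, hc⟩ := Finite.exists_max
    (fun c : Fin N → Fin (N + 1) => ∑ j, ‖∑ n with c n = j, y n‖ ^ q)
  obtain ⟨j₀, hj₀⟩ : ∃ j₀, ∀ n, c n ≠ j₀ := by
    by_contra! h
    have := Fintype.card_le_of_surjective c h
    simp at this
  choose g hg hgy using fun j => exists_dual_vector'' ℝ (∑ n with c n = j, y n)
  let u : Fin (N + 1) → ℝ := fun j => ‖∑ n with c n = j, y n‖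
  let μ : Fin N → ℝ := fun n => q * u (c n) ^ (q - 1) * g (c n) (y n)
  have hfib (B : Finset (Fin N)) :
      ∑ n ∈ B, μ n = ∑ j, q * u j ^ (q - 1) * g j (∑ n ∈ B with c n = j, y n) := by
    rw [← Finset.sum_fiberwise B c]
    refine Finset.sum_congr rfl fun j _ => ?_
    rw [map_sum, Finset.mul_sum]
    refine Finset.sum_congr rfl fun n hn => ?_
    rw [← (Finset.mem_filter.1 hn).2]
  have hB (B : Finset (Fin N)) : ‖∑ n ∈ B, y n‖ ^ q ≤ ∑ n ∈ B, μ n := by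
    have hmax := hc fun n => if n ∈ B then j₀ else c n
    have hsplit (j : Fin (N + 1)) :
        ‖∑ n with (if n ∈ B then j₀ else c n) = j, y n‖ ^ q =
          (if j = j₀ then ‖∑ n ∈ B, y n‖ ^ q else 0) +
            ‖∑ n with c n = j ∧ n ∉ B, y n‖ ^ q := by
      by_cases hj : j = j₀
      · subst hj
        have h1 : (Finset.univ.filter fun n => (if n ∈ B then j else c n) = j) = B := by
          ext n; by_cases hn : n ∈ B <;> simp [hn, hj₀ n]
        have h2 : (Finset.univ.filter fun n => c n = j ∧ n ∉ B) = ∅ := by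
          ext n; simp [hj₀ n]
        rw [h1, h2]; simp [Real.zero_rpow hq0]
      · have h1 : (Finset.univ.filter fun n => (if n ∈ B then j₀ else c n) = j) =
            Finset.univ.filter fun n => c n = j ∧ n ∉ B := by
          ext n; by_cases hn : n ∈ B <;> simp [hn, Ne.symm hj]
        rw [h1]; simp [hj]
    simp only [hsplit, Finset.sum_add_distrib, Finset.sum_ite_eq', Finset.mem_univ, if_true]
      at hmax
    have hlow (j : Fin (N + 1)) :
        u j ^ q - q * u j ^ (q - 1) * g j (∑ n ∈ B with c n = j, y n) ≤
          ‖∑ n with c n = j ∧ n ∉ B, y n‖ ^ q := by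
      have hdec : ∑ n with c n = j ∧ n ∉ B, y n =
          ∑ n with c n = j, y n - ∑ n ∈ B with c n = j, y n := by
        rw [eq_sub_iff_add_eq, add_comm,
          ← Finset.sum_filter_add_sum_filter_not (Finset.univ.filter fun n => c n = j) (· ∈ B),
          Finset.filter_filter, Finset.filter_filter]
        congr 2
        ext n; simp [and_comm]
      have hge : u j - g j (∑ n ∈ B with c n = j, y n) ≤
          ‖∑ n with c n = j ∧ n ∉ B, y n‖ := by
        have h := (le_abs_self _).trans ((g j).le_of_opNorm_le (hg j)
          (∑ n with c n = j ∧ n ∉ B, y n))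
        rw [one_mul] at h
        refine le_trans (le_of_eq ?_) h
        rw [hdec, map_sub, hgy j]; rfl
      have hu : 0 ≤ u j := norm_nonneg _
      have h := rpow_add_mul_sub_le_rpow hq hu
        (norm_nonneg (∑ n with c n = j ∧ n ∉ B, y n))
      have hcoef : 0 ≤ q * u j ^ (q - 1) := by positivity
      nlinarith [mul_le_mul_of_nonneg_left hge hcoef]
    have hsum := Finset.sum_le_sum fun j (_ : j ∈ Finset.univ) => hlow j
    rw [Finset.sum_sub_distrib, ← hfib] at hsum
    change _ ≤ ∑ j, u j ^ q at hmax
    linarith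
  refine ⟨μ, fun n => ?_, ?_, hB⟩
  · have h := hB {n}
    rw [Finset.sum_singleton, Finset.sum_singleton] at h
    exact (by positivity : (0 : ℝ) ≤ ‖y n‖ ^ q).trans h
  · rw [hfib]
    refine le_of_eq_of_le ?_ (mul_le_mul_of_nonneg_left (hK c) (by linarith))
    rw [Finset.mul_sum]
    refine Finset.sum_congr rfl fun j _ => ?_
    have hu : 0 ≤ u j := norm_nonneg _
    rw [hgy j, mul_assoc]
    congr 1
    change u j ^ (q - 1) * u j = u j ^ q
    rw [← Real.rpow_add_one' hu (by simpa using hq0), sub_add_cancel]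

theorem exists_probability_dominating_norm_sum_rpow {Y : Type*} [NormedAddCommGroup Y]
    [NormedSpace ℝ Y] {N : ℕ} (hN : 0 < N) (y : Fin N → Y) {q K : ℝ} (hq : 1 < q)
    (hK : ∀ c : Fin N → Fin (N + 1), ∑ j, ‖∑ n with c n = j, y n‖ ^ q ≤ K) :
    ∃ w : Fin N → ℝ, (∀ n, 0 ≤ w n) ∧ ∑ n, w n = 1 ∧
      ∀ B : Finset (Fin N), ‖∑ n ∈ B, y n‖ ^ q ≤ q * K * ∑ n ∈ B, w n := by
  obtain ⟨μ, hμ, hμK, hB⟩ := exists_measure_dominating_norm_sum_rpow y hq hK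
  rcases (Finset.sum_nonneg fun n (_ : n ∈ Finset.univ) => hμ n).eq_or_lt with h0 | hpos
  · have hN' : (N : ℝ) ≠ 0 := by exact_mod_cast hN.ne'
    refine ⟨fun _ => 1 / N, fun _ => by positivity, by simp [hN'], fun B => ?_⟩
    have hz := (Finset.sum_eq_zero_iff_of_nonneg fun n _ => hμ n).1 h0.symm
    refine (hB B).trans ?_
    rw [Finset.sum_eq_zero fun n _ => hz n (Finset.mem_univ n)]
    exact mul_nonneg (h0.le.trans hμK) (Finset.sum_nonneg fun _ _ => by positivity)
  · refine ⟨fun n => μ n / ∑ m, μ m, fun n => div_nonneg (hμ n) hpos.le, ?_, fun B => ?_⟩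
    · rw [← Finset.sum_div, div_self hpos.ne']
    · refine (hB B).trans ?_
      rw [← Finset.sum_div]
      calc ∑ n ∈ B, μ n = (∑ m, μ m) * ((∑ n ∈ B, μ n) / ∑ m, μ m) := by field_simp
        _ ≤ _ := mul_le_mul_of_nonneg_right hμK
          (div_nonneg (Finset.sum_nonneg fun n _ => hμ n) hpos.le)

theorem integrableOn_Ioi_of_bounded_of_eq_zero {E : Type*} [NormedAddCommGroup E] {f : ℝ → E}
    {M D : ℝ} (hf : AEStronglyMeasurable f volume) (hD : ∀ t, ‖f t‖ ≤ D)
    (h0 : ∀ t, M ≤ t → f t = 0) : IntegrableOn f (Set.Ioi 0) := by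
  have h : IntegrableOn f (Set.Ioc 0 M) :=
    Measure.integrableOn_of_bounded (by simp) hf (M := D) (Filter.Eventually.of_forall hD)
  refine h.of_forall_sdiff_eq_zero measurableSet_Ioi fun t ht => h0 t ?_
  simp only [Set.mem_sdiff, Set.mem_Ioi, Set.mem_Ioc, not_and, not_le] at ht
  exact (ht.2 ht.1).le

/-- The layer cake decomposition `a = ∫₀^∞ 1_{a > t} dt`, combined with a bound for the sums over
level sets. -/
theorem norm_sum_smul_le_of_level_set_bound {Y : Type*} [NormedAddCommGroup Y] [NormedSpace ℝ Y]
    [CompleteSpace Y] {N : ℕ} (y : Fin N → Y) {q D : ℝ} (hq : 0 < q) (w : Fin N → ℝ)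
    (hw : ∀ n, 0 ≤ w n)
    (hB : ∀ B : Finset (Fin N), ‖∑ n ∈ B, y n‖ ≤ D * (∑ n ∈ B, w n) ^ (1 / q))
    (a : Fin N → ℝ) (ha : ∀ n, 0 ≤ a n) :
    ‖∑ n, a n • y n‖ ≤
      D * ∫ t in Set.Ioi (0 : ℝ), (∑ n, if t < a n then w n else 0) ^ (1 / q) := by
  have hM (n : Fin N) : a n ≤ ∑ m, a m :=
    Finset.single_le_sum (fun m _ => ha m) (Finset.mem_univ n)
  have hq' : (0 : ℝ) < 1 / q := by positivity
  have hterm (n : Fin N) :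
      IntegrableOn (fun t : ℝ => if t < a n then y n else 0) (Set.Ioi 0) := by
    refine integrableOn_Ioi_of_bounded_of_eq_zero (M := a n) (D := ‖y n‖) ?_ ?_ ?_
    · exact (StronglyMeasurable.ite measurableSet_Iio stronglyMeasurable_const
        stronglyMeasurable_const).aestronglyMeasurable
    · intro t; split_ifs <;> simp
    · intro t ht; simp [ht.not_gt]
  have hlayer : ∑ n, a n • y n =
      ∫ t in Set.Ioi (0 : ℝ), ∑ n, if t < a n then y n else 0 := by
    rw [integral_finsetSum _ fun n _ => hterm n]
    refine Finset.sum_congr rfl fun n _ => ?_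
    have h : (fun t : ℝ => if t < a n then y n else 0) =
        (Set.Iio (a n)).indicator fun _ => y n := by
      ext t; simp [Set.indicator_apply]
    rw [h, setIntegral_indicator measurableSet_Iio, Set.Ioi_inter_Iio, setIntegral_const]
    simp [Measure.real, ha n]
  have hint : IntegrableOn
      (fun t : ℝ => (∑ n, if t < a n then w n else 0) ^ (1 / q)) (Set.Ioi 0) := by
    have hnn (t : ℝ) : 0 ≤ ∑ n, if t < a n then w n else 0 :=
      Finset.sum_nonneg fun n _ => by split_ifs <;> simp [hw n]
    refine integrableOn_Ioi_of_bounded_of_eq_zero (M := ∑ m, a m)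
      (D := (∑ n, w n) ^ (1 / q)) ?_ ?_ ?_
    · refine Measurable.aestronglyMeasurable ?_
      refine Measurable.pow_const ?_ _
      exact Finset.measurable_fun_sum _ fun n _ =>
        Measurable.ite measurableSet_Iio measurable_const measurable_const
    · intro t
      rw [Real.norm_of_nonneg (Real.rpow_nonneg (hnn t) _)]
      refine Real.rpow_le_rpow (hnn t) (Finset.sum_le_sum fun n _ => ?_) hq'.le
      split_ifs <;> simp [hw n]
    · intro t ht
      rw [Finset.sum_eq_zero fun n _ => if_neg ((hM n).trans ht).not_gt,
        Real.zero_rpow hq'.ne']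
  rw [hlayer, ← integral_const_mul]
  refine (norm_integral_le_integral_norm _).trans (integral_mono
    (integrable_finsetSum _ fun n _ => hterm n).norm (hint.const_mul D) fun t => ?_)
  simpa only [Finset.sum_filter] using hB (Finset.univ.filter fun n => t < a n)

section Rademacher

variable {E : Type*} [NormedAddCommGroup E] [NormedSpace ℝ E] {N : ℕ}

theorem radAvg_nonneg (x : Fin N → E) : 0 ≤ radAvg x := by
  unfold radAvg; positivity

theorem radAvg_sign_smul (s : Fin N → Bool) (x : Fin N → E) :
    radAvg (fun n => (if s n then (1 : ℝ) else -1) • x n) = radAvg x := by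
  unfold radAvg
  congr 1
  have hinv : Function.Involutive fun (ε : Fin N → Bool) n => (ε n == s n) := by
    intro ε
    funext n
    change ((ε n == s n) == s n) = ε n
    cases ε n <;> cases s n <;> rfl
  refine Fintype.sum_equiv hinv.toPerm _ _ fun ε => ?_
  congr 2
  refine Finset.sum_congr rfl fun n _ => ?_
  change _ = (if (ε n == s n) = true then (1 : ℝ) else -1) • x n
  rcases Bool.eq_false_or_eq_true (ε n) with h | h <;>
    rcases Bool.eq_false_or_eq_true (s n) with h' | h' <;> simp [h, h']

theorem radAvg_abs_smul (a : Fin N → ℝ) (x : Fin N → E) :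
    radAvg (fun n => |a n| • x n) = radAvg fun n => a n • x n := by
  rw [← radAvg_sign_smul (fun n => decide (0 ≤ a n)) fun n => a n • x n]
  congr 1
  funext n
  by_cases h : 0 ≤ a n
  · simp [h, abs_of_nonneg h]
  · simp [h, abs_of_neg (not_le.1 h)]

/-- Cotype `q` of `X` passes to `L²(Ω; X)`, applied to the block sums of `(rₙ xₙ)`. -/
theorem sum_radAvg_block_rpow_le {q C : ℝ} (hq : 2 ≤ q) (hC : 0 ≤ C)
    (hX : ∀ (M : ℕ) (z : Fin M → E),
      (∑ j, ‖z j‖ ^ q) ^ (1 / q) ≤ C * Real.sqrt (radAvg z))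
    {M : ℕ} (c : Fin N → Fin M) (x : Fin N → E) :
    ∑ j, Real.sqrt (radAvg fun n => if c n = j then x n else 0) ^ q ≤
      (C * Real.sqrt (radAvg x)) ^ q := by
  have hq0 : 0 < q := by linarith
  let z : (Fin N → Bool) → Fin M → E := fun ω j =>
    ∑ n, (if ω n then (1 : ℝ) else -1) • if c n = j then x n else 0
  have hpt (ω : Fin N → Bool) :
      (∑ j, (‖z ω j‖ ^ 2) ^ (q / 2)) ^ (1 / (q / 2)) ≤ C ^ 2 * radAvg (z ω) := by
    have h := pow_le_pow_left₀ (by positivity) (hX M (z ω)) 2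
    rw [mul_pow, Real.sq_sqrt (radAvg_nonneg _), ← Real.rpow_natCast (_ ^ (1 / q)),
      ← Real.rpow_mul (by positivity)] at h
    have hsum : ∑ j, (‖z ω j‖ ^ 2) ^ (q / 2) = ∑ j, ‖z ω j‖ ^ q := by
      refine Finset.sum_congr rfl fun j _ => ?_
      rw [← Real.rpow_natCast, ← Real.rpow_mul (norm_nonneg _)]
      congr 1; push_cast; ring
    have hexp : 1 / (q / 2) = 1 / q * ((2 : ℕ) : ℝ) := by push_cast; field_simp
    rwa [hsum, hexp]
  have havg : ∑ ω, radAvg (z ω) = 2 ^ N * radAvg x := by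
    have hsigns (ε : Fin M → Bool) :
        ∑ ω, ‖∑ j, (if ε j then (1 : ℝ) else -1) • z ω j‖ ^ 2 = 2 ^ N * radAvg x := by
      rw [← radAvg_sign_smul (fun n => ε (c n)) x]
      unfold radAvg
      rw [mul_div_cancel₀ _ (by positivity)]
      refine Finset.sum_congr rfl fun ω _ => ?_
      congr 2
      simp only [z, Finset.smul_sum]
      rw [Finset.sum_comm]
      refine Finset.sum_congr rfl fun n _ => ?_
      rw [Finset.sum_eq_single (c n)]
      · simp only [if_true]; rw [smul_comm]
      · intro j _ hj; simp [Ne.symm hj]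
      · simp
    calc ∑ ω, radAvg (z ω)
        = (∑ ε : Fin M → Bool, ∑ ω, ‖∑ j, (if ε j then (1 : ℝ) else -1) • z ω j‖ ^ 2)
            / 2 ^ M := by
          unfold radAvg; rw [← Finset.sum_div, Finset.sum_comm]
      _ = 2 ^ N * radAvg x := by
          simp only [hsigns, Finset.sum_const, Finset.card_univ, Fintype.card_fun,
            Fintype.card_bool, Fintype.card_fin, nsmul_eq_mul]
          push_cast; field_simp
  have hmink := Lp_sum_le_of_nonneg (p := q / 2) (by linarith) Finset.univ
    (fun ω j => ‖z ω j‖ ^ 2 / 2 ^ N) fun _ _ => by positivity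
  have hscale (ω : Fin N → Bool) :
      (∑ j, (‖z ω j‖ ^ 2 / 2 ^ N) ^ (q / 2)) ^ (1 / (q / 2)) =
        (∑ j, (‖z ω j‖ ^ 2) ^ (q / 2)) ^ (1 / (q / 2)) / 2 ^ N := by
    simp only [Real.div_rpow (sq_nonneg _) (by positivity : (0 : ℝ) ≤ 2 ^ N)]
    rw [← Finset.sum_div, Real.div_rpow (by positivity) (by positivity),
      ← Real.rpow_mul (by positivity : (0 : ℝ) ≤ 2 ^ N), mul_one_div_cancel (by positivity),
      Real.rpow_one]
  simp only [hscale] at hmink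
  have hbound : (∑ j, (∑ ω, ‖z ω j‖ ^ 2 / 2 ^ N) ^ (q / 2)) ^ (1 / (q / 2)) ≤
      C ^ 2 * radAvg x := by
    refine hmink.trans ?_
    rw [← Finset.sum_div, div_le_iff₀ (by positivity)]
    calc _ ≤ ∑ ω, C ^ 2 * radAvg (z ω) := Finset.sum_le_sum fun ω _ => hpt ω
      _ = C ^ 2 * radAvg x * 2 ^ N := by rw [← Finset.mul_sum, havg]; ring
  have hpow := Real.rpow_le_rpow (by positivity) hbound (by positivity : 0 ≤ q / 2)
  rw [← Real.rpow_mul (by positivity), one_div_mul_cancel (by positivity), Real.rpow_one] at hpow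
  have hsqrt {r : ℝ} (hr : 0 ≤ r) : Real.sqrt r ^ q = r ^ (q / 2) := by
    rw [Real.sqrt_eq_rpow, ← Real.rpow_mul hr]
    congr 1; ring
  have hCx : C * Real.sqrt (radAvg x) = Real.sqrt (C ^ 2 * radAvg x) := by
    rw [Real.sqrt_mul (sq_nonneg C), Real.sqrt_sq hC]
  rw [hCx, hsqrt (mul_nonneg (sq_nonneg C) (radAvg_nonneg x))]
  refine le_of_eq_of_le (Finset.sum_congr rfl fun j _ => ?_) hpow
  rw [hsqrt (radAvg_nonneg _)]
  simp only [radAvg, z, Finset.sum_div]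

/-- The vector `rₙ xₙ` as an element of the `ℓ²` space of functions of the signs. -/
def radVec (x : Fin N → E) (n : Fin N) : PiLp 2 fun _ : Fin N → Bool => E :=
  WithLp.toLp 2 fun ε => (if ε n then (1 : ℝ) else -1) • x n

theorem norm_sum_smul_radVec (a : Fin N → ℝ) (x : Fin N → E) :
    ‖∑ n, a n • radVec x n‖ = Real.sqrt (2 ^ N) * Real.sqrt (radAvg fun n => a n • x n) := by
  rw [← Real.sqrt_mul (by positivity), PiLp.norm_eq_of_L2]
  congr 1
  unfold radAvg
  rw [mul_div_cancel₀ _ (by positivity)]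
  refine Finset.sum_congr rfl fun ε _ => ?_
  congr 2
  simp only [radVec, WithLp.ofLp_sum, WithLp.ofLp_smul, Finset.sum_apply, Pi.smul_apply]
  exact Finset.sum_congr rfl fun n _ => smul_comm _ _ _

end Rademacher

/-- The factorization step in the proof of Lemma 3.1: if `X` has cotype `q ∈ [2,∞)`, there is
`C` such that for every `x₁,…,x_N ∈ X` there is a probability measure `ν` (weights `w`) on
`{1,…,N}` with
`(𝔼‖∑ rₙ aₙ xₙ‖²)^{1/2} ≤ C ‖(aₙ)‖_{ℓ^{q,1}(ν)} (𝔼‖∑ rₙ xₙ‖²)^{1/2}` for all scalars `a`,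
where `‖(aₙ)‖_{ℓ^{q,1}(ν)} = q ∫₀^∞ ν(|a| > t)^{1/q} dt`. -/
theorem statement19 {X : Type*} [NormedAddCommGroup X] [NormedSpace ℝ X] [CompleteSpace X]
    (q : ℝ) (hq : 2 ≤ q) (hX : HasRademacherCotype X (ENNReal.ofReal q)) :
    ∃ C : ℝ, 0 ≤ C ∧ ∀ (N : ℕ), 0 < N → ∀ x : Fin N → X, ∃ w : Fin N → ℝ,
      (∀ n, 0 ≤ w n) ∧ (∑ n, w n) = 1 ∧
      ∀ a : Fin N → ℝ,
        Real.sqrt (radAvg fun n => a n • x n) ≤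
          C * (q * ∫ t in Set.Ioi (0 : ℝ), (∑ n, if t < |a n| then w n else 0) ^ (1 / q)) *
            Real.sqrt (radAvg x) := by
  obtain ⟨C, hC, hcot⟩ := hX
  have hq0 : 0 < q := by linarith
  simp only [ENNReal.ofReal_ne_top, if_false, ENNReal.toReal_ofReal hq0.le] at hcot
  refine ⟨q ^ (1 / q) * C, by positivity, fun N hN x => ?_⟩
  have hs : 0 < Real.sqrt (2 ^ N) := by positivity
  obtain ⟨w, hw, hw1, hB⟩ := exists_probability_dominating_norm_sum_rpow hN (radVec x)
    (q := q) (K := (Real.sqrt (2 ^ N) * (C * Real.sqrt (radAvg x))) ^ q) (by linarith) (by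
      intro c
      have hblock (j : Fin (N + 1)) : ‖∑ n with c n = j, radVec x n‖ =
          Real.sqrt (2 ^ N) * Real.sqrt (radAvg fun n => if c n = j then x n else 0) := by
        have h := norm_sum_smul_radVec (fun n => if c n = j then 1 else 0) x
        simpa only [ite_smul, one_smul, zero_smul, ← Finset.sum_filter] using h
      simp only [hblock, Real.mul_rpow hs.le (Real.sqrt_nonneg _)]
      rw [← Finset.mul_sum, Real.mul_rpow hs.le (by positivity)]
      exact mul_le_mul_of_nonneg_left (sum_radAvg_block_rpow_le hq hC hcot c x) (by positivity))
  refine ⟨w, hw, hw1, fun a => ?_⟩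
  set D := Real.sqrt (2 ^ N) * (C * Real.sqrt (radAvg x)) with hD
  have hD0 : 0 ≤ D := by positivity
  have hB' (B : Finset (Fin N)) :
      ‖∑ n ∈ B, radVec x n‖ ≤ q ^ (1 / q) * D * (∑ n ∈ B, w n) ^ (1 / q) := by
    have hwB : 0 ≤ ∑ n ∈ B, w n := Finset.sum_nonneg fun n _ => hw n
    have h := Real.rpow_le_rpow (by positivity) (hB B) (by positivity : 0 ≤ 1 / q)
    rwa [← Real.rpow_mul (norm_nonneg _), mul_one_div_cancel hq0.ne', Real.rpow_one,
      Real.mul_rpow (by positivity) hwB, Real.mul_rpow hq0.le (by positivity),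
      ← Real.rpow_mul hD0, mul_one_div_cancel hq0.ne', Real.rpow_one] at h
  have h := norm_sum_smul_le_of_level_set_bound (radVec x) hq0 w hw hB' (fun n => |a n|)
    fun n => abs_nonneg _
  rw [norm_sum_smul_radVec, radAvg_abs_smul] at h
  have hI : 0 ≤ ∫ t in Set.Ioi (0 : ℝ), (∑ n, if t < |a n| then w n else 0) ^ (1 / q) :=
    integral_nonneg fun t => Real.rpow_nonneg
      (Finset.sum_nonneg fun n _ => by split_ifs <;> simp [hw n]) _
  set I := ∫ t in Set.Ioi (0 : ℝ), (∑ n, if t < |a n| then w n else 0) ^ (1 / q)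
  refine le_of_mul_le_mul_left (h.trans ?_) hs
  have hfac : 0 ≤ q ^ (1 / q) * D * I := by positivity
  calc q ^ (1 / q) * D * I ≤ q * (q ^ (1 / q) * D * I) :=
        le_mul_of_one_le_left hfac (by linarith)
    _ = _ := by rw [hD]; ring
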